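/- Let m ≥ 2 be an integer, a an integer with 0 ≤ a ≤ m−2, q a complex number with 0 < |q| < 1, and x a complex number. Then the series K_m^{(a)}(x) = Σ_{c_1,…,c_{m−1}=0}^{∞} (−1)^{c_{m−1}} q^{c_{m−1}(c_{m−1}+1)/2} x^{c_1+⋯+c_{m−1}} q^{c_1²+⋯+c_{m−2}² + c_{a+1}+⋯+c_{m−2}} Π_{i=1}^{m−2} [c_{i+1}+δ_{i,a} choose c_i]_q satisfies the q-difference equation K_m^{(a)}(x) = 1 − q^{a+1} x^{a+1} + x^m q^{2m−1−a} K_m^{(a)}(q² x). -/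

import Mathlib

open scoped BigOperators

/-- The Gaussian binomial coefficient `[M choose n]_q`: equal to
`(q)_M/((q)_n (q)_{M−n})` for `M ≥ n ≥ 0` and to `0` otherwise; defined via the
`q`-Pascal recursion (hence an integer polynomial in `q`). -/
def qBinom (q : ℂ) : ℕ → ℕ → ℂ
  | _, 0 => 1
  | 0, _ + 1 => 0
  | M + 1, n + 1 => q ^ (n + 1) * qBinom q M (n + 1) + qBinom q M n

/-- The general term of the multiple series `K_m^{(a)}(x)` with `m = p + 2`:
for `c : Fin (p+1) → ℕ` (where `c j` is `c_{j+1}`, `j = 0,…,p`), the term is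
`(−1)^{c_{m−1}} q^{c_{m−1}(c_{m−1}+1)/2} x^{c_1+⋯+c_{m−1}}
 q^{c_1²+⋯+c_{m−2}² + c_{a+1}+⋯+c_{m−2}} Π_{i=1}^{m−2} [c_{i+1}+δ_{i,a} choose c_i]_q`. -/
noncomputable def Kterm (p a : ℕ) (q x : ℂ) (c : Fin (p + 1) → ℕ) : ℂ :=
  (-1 : ℂ) ^ (c (Fin.last p)) *
    q ^ ((c (Fin.last p) * (c (Fin.last p) + 1)) / 2) *
    x ^ (∑ j : Fin (p + 1), c j) *
    q ^ ((∑ j : Fin p, (c j.castSucc) ^ 2) +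
          ∑ j : Fin p, (if a ≤ (j : ℕ) then c j.castSucc else 0)) *
    ∏ j : Fin p,
      qBinom q (c j.succ + (if (j : ℕ) + 1 = a then 1 else 0)) (c j.castSucc)

/-- The `q`-shifted factorial `(yq; q)_n = ∏_{k=1}^{n} (1 - y q^k)`. -/
def shiftedPoch (q y : ℂ) (n : ℕ) : ℂ := ∏ k ∈ Finset.range n, (1 - y * q ^ (k + 1))

lemma shiftedPoch_zero (q y : ℂ) : shiftedPoch q y 0 = 1 := by simp [shiftedPoch]

lemma shiftedPoch_succ (q y : ℂ) (n : ℕ) :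
    shiftedPoch q y (n + 1) = shiftedPoch q y n * (1 - y * q ^ (n + 1)) := by
  simp [shiftedPoch, Finset.prod_range_succ]

lemma shiftedPoch_add (q y : ℂ) (m n : ℕ) :
    shiftedPoch q y (m + n) = shiftedPoch q y m * shiftedPoch q (y * q ^ m) n := by
  simp only [shiftedPoch, Finset.prod_range_add]
  congr 1
  refine Finset.prod_congr rfl fun k _ => ?_
  ring

lemma shiftedPoch_succ' (q y : ℂ) (n : ℕ) :
    shiftedPoch q y (n + 1) = (1 - y * q) * shiftedPoch q (y * q) n := by
  rw [add_comm, shiftedPoch_add]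
  simp [shiftedPoch]

lemma norm_mul_pow_le {q y : ℂ} (hq : ‖q‖ < 1) (hy : ‖y‖ ≤ 1) (n : ℕ) : ‖y * q ^ n‖ ≤ 1 := by
  rw [norm_mul, norm_pow]
  exact mul_le_one₀ hy (by positivity) (pow_le_one₀ (norm_nonneg _) hq.le)

lemma norm_mul_pow_succ_le {q y : ℂ} (hq : ‖q‖ < 1) (hy : ‖y‖ ≤ 1) (n : ℕ) :
    ‖y * q ^ (n + 1)‖ ≤ ‖q‖ := by
  rw [pow_succ, ← mul_assoc, norm_mul]
  exact mul_le_of_le_one_left (norm_nonneg _) (norm_mul_pow_le hq hy n)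

lemma one_sub_mul_pow_ne_zero {q y : ℂ} (hq : ‖q‖ < 1) (hy : ‖y‖ ≤ 1) (n : ℕ) :
    1 - y * q ^ (n + 1) ≠ 0 := by
  intro h
  have h1 := norm_mul_pow_succ_le hq hy n
  rw [← sub_eq_zero.mp h, norm_one] at h1
  linarith

lemma shiftedPoch_ne_zero {q y : ℂ} (hq : ‖q‖ < 1) (hy : ‖y‖ ≤ 1) (n : ℕ) :
    shiftedPoch q y n ≠ 0 :=
  Finset.prod_ne_zero_iff.mpr fun k _ => one_sub_mul_pow_ne_zero hq hy k

lemma qBinom_zero_right (q : ℂ) (n : ℕ) : qBinom q n 0 = 1 := by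
  cases n <;> rfl

lemma qBinom_succ_succ (q : ℂ) (n k : ℕ) :
    qBinom q (n + 1) (k + 1) = q ^ (k + 1) * qBinom q n (k + 1) + qBinom q n k := rfl

lemma qBinom_eq_zero_of_lt (q : ℂ) {n k : ℕ} (h : n < k) : qBinom q n k = 0 := by
  induction n generalizing k with
  | zero => obtain ⟨k, rfl⟩ := Nat.exists_eq_succ_of_ne_zero (by omega : k ≠ 0); rfl
  | succ n ih =>
    obtain ⟨k, rfl⟩ := Nat.exists_eq_succ_of_ne_zero (by omega : k ≠ 0)
    rw [Nat.succ_eq_add_one, qBinom_succ_succ, ih (by omega), ih (by omega)]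
    simp

lemma qBinom_self (q : ℂ) (n : ℕ) : qBinom q n n = 1 := by
  induction n with
  | zero => rfl
  | succ n ih => rw [qBinom_succ_succ, ih, qBinom_eq_zero_of_lt q (Nat.lt_succ_self n)]; simp

lemma qBinom_add_mul_shiftedPoch (q : ℂ) (n k : ℕ) :
    qBinom q (n + k) n * (shiftedPoch q 1 n * shiftedPoch q 1 k) = shiftedPoch q 1 (n + k) := by
  obtain ⟨s, hs⟩ : ∃ s, n + k = s := ⟨_, rfl⟩
  induction s generalizing n k with
  | zero =>
    obtain ⟨rfl, rfl⟩ : n = 0 ∧ k = 0 := by omega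
    simp [qBinom_zero_right, shiftedPoch_zero]
  | succ s ih =>
    rcases n with _ | n
    · simp [qBinom_zero_right, shiftedPoch_zero]
    rcases k with _ | k
    · simp [qBinom_self, shiftedPoch_zero]
    have h1 := ih (n + 1) k (by omega)
    have h2 := ih n (k + 1) (by omega)
    rw [show n + 1 + (k + 1) = (n + 1 + k) + 1 by ring, qBinom_succ_succ,
      shiftedPoch_succ q 1 (n + 1 + k), ← h1]
    rw [show n + (k + 1) = n + 1 + k by ring] at h2
    rw [← h1] at h2
    rw [shiftedPoch_succ q 1 k, shiftedPoch_succ q 1 n] at *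
    linear_combination (1 - 1 * q ^ (n + 1)) * h2

/-- The second `q`-Pascal recursion. -/
lemma qBinom_succ_succ' {q : ℂ} (hq : ‖q‖ < 1) (n k : ℕ) :
    qBinom q (n + 1) (k + 1) * q ^ (k + 1) =
      q ^ (k + 1) * qBinom q n (k + 1) + q ^ (n + 1) * qBinom q n k := by
  rcases lt_trichotomy n k with h | rfl | h
  · simp [qBinom_eq_zero_of_lt q h, qBinom_eq_zero_of_lt q (Nat.lt_succ_of_lt h),
      qBinom_eq_zero_of_lt q (Nat.succ_lt_succ h)]
  · simp [qBinom_self, qBinom_eq_zero_of_lt q (Nat.lt_succ_self n)]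
  · obtain ⟨d, rfl⟩ := Nat.exists_eq_add_of_lt h
    have h1 := qBinom_add_mul_shiftedPoch q (k + 1) d
    have h2 := qBinom_add_mul_shiftedPoch q k (d + 1)
    rw [show k + 1 + d = k + d + 1 by ring] at h1
    rw [show k + (d + 1) = k + d + 1 by ring, ← h1] at h2
    have hne : ∀ n, shiftedPoch q 1 n ≠ 0 := shiftedPoch_ne_zero hq (by simp)
    have hk := hne k
    have hd := hne d
    rw [shiftedPoch_succ q 1 k, shiftedPoch_succ q 1 d] at h2
    have h3 : qBinom q (k + d + 1) k * (1 - q ^ (d + 1)) =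
        qBinom q (k + d + 1) (k + 1) * (1 - q ^ (k + 1)) := by
      apply mul_left_cancel₀ (mul_ne_zero hk hd)
      linear_combination h2
    rw [qBinom_succ_succ]
    linear_combination (q ^ (k + 1)) * h3

/-- The limiting `q`-Chu--Vandermonde sum. -/
lemma sum_qBinom_div_shiftedPoch {q : ℂ} (hq0 : q ≠ 0) (hq : ‖q‖ < 1) (n : ℕ) {z : ℂ}
    (hz : ‖z‖ ≤ 1) :
    ∑ k ∈ Finset.range (n + 1), z ^ k * q ^ k ^ 2 * qBinom q n k / shiftedPoch q z k =
      (shiftedPoch q z n)⁻¹ := by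
  induction n generalizing z with
  | zero => simp [shiftedPoch_zero, qBinom_zero_right]
  | succ n ih =>
    have hzq : ‖z * q‖ ≤ 1 := by simpa using norm_mul_pow_le hq hz 1
    have hz1 : 1 - z * q ≠ 0 := by simpa using one_sub_mul_pow_ne_zero hq hz 0
    have key : ∀ k, z ^ (k + 1) * q ^ (k + 1) ^ 2 * qBinom q (n + 1) (k + 1) /
        shiftedPoch q z (k + 1) =
        z ^ (k + 1) * q ^ (k + 1) ^ 2 * qBinom q n (k + 1) / shiftedPoch q z (k + 1) +
        z * q ^ (n + 1) / (1 - z * q) *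
          ((z * q) ^ k * q ^ k ^ 2 * qBinom q n k / shiftedPoch q (z * q) k) := by
      intro k
      have hk := shiftedPoch_ne_zero hq hzq k
      rw [shiftedPoch_succ']
      field_simp
      rw [mul_pow]
      have := qBinom_succ_succ' hq n k
      have e : q ^ (k + 1) ^ 2 = q ^ (k + 1) * (q ^ k * q ^ k ^ 2) := by ring
      rw [e]
      linear_combination (z ^ (k + 1) * q ^ k * q ^ k ^ 2) * this
    rw [Finset.sum_range_succ', Finset.sum_congr rfl (fun k _ => key k), Finset.sum_add_distrib,
      ← Finset.mul_sum, ih hzq]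
    have h2 := ih hz
    rw [Finset.sum_range_succ'] at h2
    rw [Finset.sum_range_succ, qBinom_eq_zero_of_lt q (Nat.lt_succ_self n)]
    simp only [qBinom_zero_right, shiftedPoch_zero] at h2 ⊢
    have hn := shiftedPoch_ne_zero hq hz n
    have hn' := shiftedPoch_ne_zero hq hz (n + 1)
    have h3 : z * q ^ (n + 1) / (1 - z * q) * (shiftedPoch q (z * q) n)⁻¹ =
        z * q ^ (n + 1) / shiftedPoch q z (n + 1) := by
      rw [shiftedPoch_succ']; field_simp
    rw [h3]
    have h4 : (shiftedPoch q z n)⁻¹ = (1 - z * q ^ (n + 1)) / shiftedPoch q z (n + 1) := by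
      rw [shiftedPoch_succ] at hn' ⊢
      have := right_ne_zero_of_mul hn'
      field_simp
    rw [h4] at h2
    linear_combination h2 - inv_eq_one_div (shiftedPoch q z (n + 1))

/-- The Bailey kernel `(q)_n / ((q)_{n-r} (yq)_{n+r})`, without the factor `(q)_r`. -/
noncomputable def baileyKernel (q y : ℂ) (n r : ℕ) : ℂ :=
  qBinom q n r / shiftedPoch q y (n + r)

lemma baileyKernel_eq_zero_of_lt (q y : ℂ) {n r : ℕ} (h : n < r) : baileyKernel q y n r = 0 := by
  simp [baileyKernel, qBinom_eq_zero_of_lt q h]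

lemma qBinom_mul_qBinom {q : ℂ} (hq : ‖q‖ < 1) (n r k : ℕ) (hk : k ≤ n) :
    qBinom q (r + n) (r + k) * qBinom q (r + k) r = qBinom q (r + n) r * qBinom q n k := by
  obtain ⟨d, rfl⟩ := Nat.exists_eq_add_of_le hk
  have h1 := qBinom_add_mul_shiftedPoch q (r + k) d
  have h2 := qBinom_add_mul_shiftedPoch q r k
  have h3 := qBinom_add_mul_shiftedPoch q r (k + d)
  have h4 := qBinom_add_mul_shiftedPoch q k d
  have hne : ∀ n, shiftedPoch q 1 n ≠ 0 := shiftedPoch_ne_zero hq (by simp)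
  rw [← h2, add_assoc] at h1
  rw [← h4, ← h1] at h3
  apply mul_left_cancel₀ (mul_ne_zero (mul_ne_zero (hne r) (hne k)) (hne d))
  linear_combination -h3

lemma sum_qBinom_mul_baileyKernel {q : ℂ} (hq0 : q ≠ 0) (hq : ‖q‖ < 1) {y : ℂ} (hy : ‖y‖ ≤ 1)
    (n r : ℕ) :
    ∑ k ∈ Finset.range (n + 1), y ^ k * q ^ k ^ 2 * qBinom q n k * baileyKernel q y k r =
      y ^ r * q ^ r ^ 2 * baileyKernel q y n r := by
  rcases lt_or_ge n r with h | h
  · rw [baileyKernel_eq_zero_of_lt q y h, mul_zero]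
    refine Finset.sum_eq_zero fun k hk => ?_
    rw [baileyKernel_eq_zero_of_lt q y (by have := Finset.mem_range.mp hk; omega), mul_zero]
  obtain ⟨n, rfl⟩ := Nat.exists_eq_add_of_le h
  rw [add_assoc, Finset.sum_range_add, Finset.sum_eq_zero, zero_add]
  swap
  · intro k hk
    rw [baileyKernel_eq_zero_of_lt q y (Finset.mem_range.mp hk), mul_zero]
  have hz : ‖y * q ^ (r + r)‖ ≤ 1 := norm_mul_pow_le hq hy _
  have hsum := sum_qBinom_div_shiftedPoch hq0 hq n hz
  have hp := shiftedPoch_ne_zero hq hy (r + r)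
  have key : ∀ k ∈ Finset.range (n + 1),
      y ^ (r + k) * q ^ (r + k) ^ 2 * qBinom q (r + n) (r + k) * baileyKernel q y (r + k) r =
      y ^ r * q ^ r ^ 2 * qBinom q (r + n) r / shiftedPoch q y (r + r) *
        ((y * q ^ (r + r)) ^ k * q ^ k ^ 2 * qBinom q n k / shiftedPoch q (y * q ^ (r + r)) k) := by
    intro k hk
    have := qBinom_mul_qBinom hq n r k (by have := Finset.mem_range.mp hk; omega)
    have hk := shiftedPoch_ne_zero hq hz k
    rw [baileyKernel, show r + k + r = r + r + k by ring, shiftedPoch_add]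
    field_simp
    rw [show q ^ (r + k) ^ 2 = q ^ (r ^ 2) * (q ^ (r + r)) ^ k * q ^ (k ^ 2) by ring]
    rw [mul_pow]
    linear_combination (y ^ (r + k) * (q ^ (r ^ 2) * (q ^ (r + r)) ^ k * q ^ (k ^ 2))) * this
  rw [Finset.sum_congr rfl key, ← Finset.mul_sum, hsum, baileyKernel,
    show r + n + r = r + r + n by ring, shiftedPoch_add q y (r + r) n]
  have hn := shiftedPoch_ne_zero hq hz n
  field_simp

/-- The `β`-sequence, multiplied by `(q)_n`, that the Bailey kernel attaches to `A`. -/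
noncomputable def baileySum (q y : ℂ) (A : ℕ → ℂ) (n : ℕ) : ℂ :=
  ∑ r ∈ Finset.range (n + 1), A r * baileyKernel q y n r

lemma baileySum_eq_sum_range (q y : ℂ) (A : ℕ → ℂ) {n N : ℕ} (h : n ≤ N) :
    baileySum q y A n = ∑ r ∈ Finset.range (N + 1), A r * baileyKernel q y n r := by
  refine Finset.sum_subset (Finset.range_mono (by omega)) fun r _ hr => ?_
  rw [baileyKernel_eq_zero_of_lt q y (by simpa [Nat.lt_succ_iff] using hr), mul_zero]

/-- Bailey's lemma with both parameters sent to infinity. -/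
lemma sum_qBinom_mul_baileySum {q : ℂ} (hq0 : q ≠ 0) (hq : ‖q‖ < 1) {y : ℂ} (hy : ‖y‖ ≤ 1)
    (A : ℕ → ℂ) (n : ℕ) :
    ∑ k ∈ Finset.range (n + 1), y ^ k * q ^ k ^ 2 * qBinom q n k * baileySum q y A k =
      baileySum q y (fun r => y ^ r * q ^ r ^ 2 * A r) n := by
  have h : ∀ k ∈ Finset.range (n + 1),
      y ^ k * q ^ k ^ 2 * qBinom q n k * baileySum q y A k =
      ∑ r ∈ Finset.range (n + 1),
        A r * (y ^ k * q ^ k ^ 2 * qBinom q n k * baileyKernel q y k r) := by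
    intro k hk
    rw [baileySum_eq_sum_range q y A (Nat.lt_succ_iff.mp (Finset.mem_range.mp hk)),
      Finset.mul_sum]
    exact Finset.sum_congr rfl fun r _ => by ring
  rw [Finset.sum_congr rfl h, Finset.sum_comm, baileySum]
  refine Finset.sum_congr rfl fun r _ => ?_
  rw [← Finset.mul_sum, sum_qBinom_mul_baileyKernel hq0 hq hy]
  ring

/-- The factor `(1 - x q^{2r}) (x)_r / (1 - x)`, in a form free of the division. -/
noncomputable def unitFactor (q x : ℂ) : ℕ → ℂ
  | 0 => 1
  | r + 1 => shiftedPoch q x r * (1 - x * q ^ (2 * (r + 1)))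

/-- The image of the unit Bailey pair relative to `x` after `j` steps of Bailey's lemma. -/
noncomputable def unitAlpha (q x : ℂ) (j r : ℕ) : ℂ :=
  unitFactor q x r * ((-1) ^ r * q ^ r.choose 2 * x ^ (j * r) * q ^ (j * r ^ 2))

/-- The sequence obtained from `unitAlpha` on changing the parameter from `x` to `xq`. -/
noncomputable def shiftedAlpha (q x : ℂ) (j r : ℕ) : ℂ :=
  (1 - x * q)⁻¹ * shiftedPoch q x r * ((-1) ^ r * q ^ (r + 1).choose 2 * x ^ (j * r) *
    q ^ (j * r ^ 2) * (1 - x ^ j * q ^ (j * (2 * r + 1))))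

lemma choose_two_succ (r : ℕ) : (r + 1).choose 2 = r + r.choose 2 := by
  rw [Nat.choose_succ_succ' r 1, Nat.choose_one_right]

lemma one_sub_mul_baileyKernel {q : ℂ} (hq : ‖q‖ < 1) {x : ℂ} (hx : ‖x‖ ≤ 1) (n r : ℕ) :
    (1 - x * q ^ (2 * (r + 1))) * baileyKernel q x (n + 1) (r + 1) =
      (1 - x * q)⁻¹ * (q ^ (r + 1) * (1 - x * q ^ (r + 1)) * baileyKernel q (x * q) n (r + 1) +
        baileyKernel q (x * q) n r) := by
  have hxq : ‖x * q‖ ≤ 1 := by simpa using norm_mul_pow_le hq hx 1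
  have h1 : 1 - x * q ≠ 0 := by simpa using one_sub_mul_pow_ne_zero hq hx 0
  have h2 := shiftedPoch_ne_zero hq hxq (n + r)
  have h3 : 1 - (x * q) * q ^ (n + r + 1) ≠ 0 := one_sub_mul_pow_ne_zero hq hxq (n + r)
  have p1 := qBinom_succ_succ' hq n r
  have p2 := qBinom_succ_succ q n r
  simp only [baileyKernel]
  rw [show n + 1 + (r + 1) = n + r + 1 + 1 by ring, shiftedPoch_succ',
    show n + (r + 1) = n + r + 1 by ring, shiftedPoch_succ q (x * q) (n + r)]
  field_simp
  linear_combination p2 - x * q ^ (r + 1) * p1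

lemma baileySum_unitAlpha {q : ℂ} (hq : ‖q‖ < 1) {x : ℂ} (hx : ‖x‖ ≤ 1) (j n : ℕ) :
    baileySum q x (unitAlpha q x j) (n + 1) = baileySum q (x * q) (shiftedAlpha q x j) n := by
  set s : ℕ → ℂ := fun r => (-1) ^ r * q ^ r.choose 2 * x ^ (j * r) * q ^ (j * r ^ 2) with hs
  have h1 : 1 - x * q ≠ 0 := by simpa using one_sub_mul_pow_ne_zero hq hx 0
  have hA : ∀ r, shiftedAlpha q x j r = (1 - x * q)⁻¹ * shiftedPoch q x r *
      (q ^ r * s r + s (r + 1)) := by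
    intro r
    simp only [shiftedAlpha, hs, choose_two_succ]
    ring
  have hU : ∀ r, unitAlpha q x j (r + 1) * baileyKernel q x (n + 1) (r + 1) =
      (1 - x * q)⁻¹ * (shiftedPoch q x (r + 1) * q ^ (r + 1) * s (r + 1) *
        baileyKernel q (x * q) n (r + 1)) +
      (1 - x * q)⁻¹ * shiftedPoch q x r * s (r + 1) * baileyKernel q (x * q) n r := by
    intro r
    have := one_sub_mul_baileyKernel hq hx n r
    rw [shiftedPoch_succ]
    simp only [unitAlpha, unitFactor]
    change shiftedPoch q x r * (1 - x * q ^ (2 * (r + 1))) * s (r + 1) * _ = _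
    linear_combination (shiftedPoch q x r * s (r + 1)) * this
  have hR : ∀ r, shiftedAlpha q x j r * baileyKernel q (x * q) n r =
      (1 - x * q)⁻¹ * (shiftedPoch q x r * q ^ r * s r * baileyKernel q (x * q) n r) +
      (1 - x * q)⁻¹ * shiftedPoch q x r * s (r + 1) * baileyKernel q (x * q) n r := by
    intro r; rw [hA]; ring
  have h0 : unitAlpha q x j 0 * baileyKernel q x (n + 1) 0 =
      (1 - x * q)⁻¹ * (shiftedPoch q x 0 * q ^ 0 * s 0 * baileyKernel q (x * q) n 0) := by
    simp only [unitAlpha, unitFactor, baileyKernel, qBinom_zero_right, shiftedPoch_zero, hs,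
      add_zero, shiftedPoch_succ', mul_inv, one_div]
    simp
  rw [baileySum, Finset.sum_range_succ', Finset.sum_congr rfl (fun r _ => hU r),
    Finset.sum_add_distrib, h0, baileySum, Finset.sum_congr rfl (fun r _ => hR r),
    Finset.sum_add_distrib, add_right_comm, ← Finset.sum_range_succ'
      (fun r => (1 - x * q)⁻¹ * (shiftedPoch q x r * q ^ r * s r * baileyKernel q (x * q) n r)),
    Finset.sum_range_succ _ (n + 1), baileyKernel_eq_zero_of_lt q _ (Nat.lt_succ_self n)]
  simp

lemma unitAlpha_succ (q x : ℂ) (j : ℕ) :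
    (fun r => x ^ r * q ^ r ^ 2 * unitAlpha q x j r) = unitAlpha q x (j + 1) := by
  funext r
  simp only [unitAlpha]
  ring

lemma baileySum_unitAlpha_zero {q : ℂ} (hq : ‖q‖ < 1) {x : ℂ} (hx : ‖x‖ ≤ 1) (n : ℕ) :
    baileySum q x (unitAlpha q x 0) n = if n = 0 then 1 else 0 := by
  rcases n with _ | n
  · simp [baileySum, unitAlpha, unitFactor, baileyKernel, qBinom_zero_right, shiftedPoch_zero]
  · rw [baileySum_unitAlpha hq hx]
    simp [baileySum, shiftedAlpha]

lemma baileySum_unitAlpha_one {q : ℂ} (hq0 : q ≠ 0) (hq : ‖q‖ < 1) {x : ℂ} (hx : ‖x‖ ≤ 1) (n : ℕ) :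
    baileySum q x (unitAlpha q x 1) n = 1 := by
  rw [← unitAlpha_succ, ← sum_qBinom_mul_baileySum hq0 hq hx]
  simp [baileySum_unitAlpha_zero hq hx, qBinom_zero_right]

/-- The factor of the summand that links the consecutive indices `k = c_{j+1}`, `n = c_{j+2}`. -/
noncomputable def link (q x : ℂ) (a j k n : ℕ) : ℂ :=
  x ^ k * q ^ (k ^ 2 + if a ≤ j then k else 0) * qBinom q (n + if j + 1 = a then 1 else 0) k

lemma link_eq_zero_of_lt (q x : ℂ) (a j : ℕ) {k n : ℕ} (h : n + 1 < k) : link q x a j k n = 0 := by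
  rw [link, qBinom_eq_zero_of_lt q (by split_ifs <;> omega), mul_zero]

/-- The inner sum over the first `p` indices, as a function of the next index. -/
noncomputable def chainSum (q x : ℂ) (a : ℕ) : ℕ → ℕ → ℂ
  | 0, _ => 1
  | p + 1, n => ∑ k ∈ Finset.range (n + 2), link q x a p k n * chainSum q x a p k

lemma chainSum_of_lt {q : ℂ} (hq0 : q ≠ 0) (hq : ‖q‖ < 1) {x : ℂ} (hx : ‖x‖ ≤ 1) {a p : ℕ}
    (h : p < a) (n : ℕ) :
    chainSum q x a p n = baileySum q x (unitAlpha q x (p + 1)) n := by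
  induction p generalizing n with
  | zero => rw [baileySum_unitAlpha_one hq0 hq hx, chainSum]
  | succ p ih =>
    rw [← unitAlpha_succ, ← sum_qBinom_mul_baileySum hq0 hq hx, chainSum, Finset.sum_range_succ]
    simp [link, qBinom_eq_zero_of_lt q (Nat.lt_succ_self n), h.ne, ih (Nat.lt_of_succ_lt h),
      (Nat.lt_of_succ_lt h).not_ge]

lemma chainSum_self {q : ℂ} (hq0 : q ≠ 0) (hq : ‖q‖ < 1) {x : ℂ} (hx : ‖x‖ ≤ 1) (a n : ℕ) :
    chainSum q x a a n = baileySum q (x * q) (shiftedAlpha q x (a + 1)) n := by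
  rw [← baileySum_unitAlpha hq hx]
  rcases a with _ | a
  · rw [baileySum_unitAlpha_one hq0 hq hx, chainSum]
  · rw [← unitAlpha_succ, ← sum_qBinom_mul_baileySum hq0 hq hx, chainSum]
    simp [link, chainSum_of_lt hq0 hq hx (Nat.lt_succ_self a)]

lemma chainSum_add {q : ℂ} (hq0 : q ≠ 0) (hq : ‖q‖ < 1) {x : ℂ} (hx : ‖x‖ ≤ 1) (a d n : ℕ) :
    chainSum q x a (a + d) n = baileySum q (x * q)
      (fun r => (x * q) ^ (d * r) * q ^ (d * r ^ 2) * shiftedAlpha q x (a + 1) r) n := by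
  have hxq : ‖x * q‖ ≤ 1 := by simpa using norm_mul_pow_le hq hx 1
  induction d generalizing n with
  | zero => simp [chainSum_self hq0 hq hx]
  | succ d ih =>
    have e : (fun r => (x * q) ^ ((d + 1) * r) * q ^ ((d + 1) * r ^ 2) *
        shiftedAlpha q x (a + 1) r) = fun r => (x * q) ^ r * q ^ r ^ 2 *
        ((x * q) ^ (d * r) * q ^ (d * r ^ 2) * shiftedAlpha q x (a + 1) r) := by
      funext r; ring
    rw [e, ← sum_qBinom_mul_baileySum hq0 hq hxq, ← add_assoc, chainSum, Finset.sum_range_succ]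
    have h1 : ¬ (a + d + 1 = a) := by omega
    simp only [link, h1, if_false, add_zero, le_add_iff_nonneg_right, zero_le, if_true,
      qBinom_eq_zero_of_lt q (Nat.lt_succ_self n), mul_zero, zero_mul, ih]
    refine Finset.sum_congr rfl fun k _ => ?_
    rw [mul_pow, pow_add]
    ring

lemma norm_qBinom_le {q : ℂ} (hq : ‖q‖ < 1) (n k : ℕ) : ‖qBinom q n k‖ ≤ 2 ^ n := by
  induction n generalizing k with
  | zero => rcases k with _ | k <;> simp [qBinom]
  | succ n ih =>
    rcases k with _ | k
    · simpa [qBinom_zero_right] using one_le_pow₀ (M₀ := ℝ) one_le_two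
    rw [qBinom_succ_succ, pow_succ (2 : ℝ), mul_two]
    refine (norm_add_le _ _).trans (add_le_add ?_ (ih k))
    rw [norm_mul, norm_pow]
    exact (mul_le_of_le_one_left (norm_nonneg _) (pow_le_one₀ (norm_nonneg _) hq.le)).trans
      (ih _)

lemma norm_inv_shiftedPoch_le {q y : ℂ} (hq : ‖q‖ < 1) (hy : ‖y‖ ≤ 1) (n : ℕ) :
    ‖(shiftedPoch q y n)⁻¹‖ ≤ (1 - ‖q‖)⁻¹ ^ n := by
  rw [norm_inv, inv_pow]
  refine inv_anti₀ (pow_pos (by linarith) _) ?_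
  rw [shiftedPoch, norm_prod]
  calc (1 - ‖q‖) ^ n = ∏ _k ∈ Finset.range n, (1 - ‖q‖) := by simp
    _ ≤ _ := Finset.prod_le_prod (fun _ _ => by linarith) fun k _ => by
      have h1 := norm_mul_pow_succ_le hq hy k
      have h2 := norm_sub_norm_le (1 : ℂ) (y * q ^ (k + 1))
      rw [norm_one] at h2
      linarith

lemma norm_shiftedPoch_le {q y : ℂ} (hq : ‖q‖ < 1) (hy : ‖y‖ ≤ 1) (n : ℕ) :
    ‖shiftedPoch q y n‖ ≤ 2 ^ n := by
  rw [shiftedPoch, norm_prod]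
  calc _ ≤ ∏ _k ∈ Finset.range n, (2 : ℝ) :=
        Finset.prod_le_prod (fun _ _ => norm_nonneg _) fun k _ => by
          have h1 := norm_mul_pow_succ_le hq hy k
          have h2 := norm_sub_le (1 : ℂ) (y * q ^ (k + 1))
          rw [norm_one] at h2
          linarith
    _ = 2 ^ n := by simp

lemma summable_pow_mul_pow_choose {s : ℝ} (hs0 : 0 ≤ s) (hs : s < 1) (R : ℝ) :
    Summable fun n : ℕ => R ^ n * s ^ (n + 1).choose 2 := by
  refine summable_of_ratio_norm_eventually_le (r := 1 / 2) (by norm_num) ?_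
  have h : Filter.Tendsto (fun n : ℕ => |R| * s ^ (n + 1)) Filter.atTop (nhds (|R| * 0)) :=
    ((tendsto_pow_atTop_nhds_zero_of_lt_one hs0 hs).comp
      (Filter.tendsto_add_atTop_nat 1)).const_mul _
  rw [mul_zero] at h
  filter_upwards [h.eventually_le_const (show (0 : ℝ) < 1 / 2 by norm_num)] with n hn
  rw [choose_two_succ (n + 1), pow_add s, pow_succ R]
  simp only [norm_mul, norm_pow, Real.norm_eq_abs, abs_of_nonneg hs0]
  calc |R| ^ n * |R| * (s ^ (n + 1) * s ^ (n + 1).choose 2)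
      = (|R| * s ^ (n + 1)) * (|R| ^ n * s ^ (n + 1).choose 2) := by ring
    _ ≤ _ := mul_le_mul_of_nonneg_right hn (by positivity)

/-- The factor of the summand that involves only the last index. -/
noncomputable def lastFactor (q x : ℂ) (n : ℕ) : ℂ := (-1) ^ n * q ^ (n + 1).choose 2 * x ^ n

lemma norm_lastFactor (q x : ℂ) (n : ℕ) :
    ‖lastFactor q x n‖ = ‖x‖ ^ n * ‖q‖ ^ (n + 1).choose 2 := by
  simp [lastFactor, mul_comm]

lemma lastFactor_succ (q x : ℂ) (n : ℕ) :
    lastFactor q x (n + 1) = -(x * q ^ (n + 1)) * lastFactor q x n := by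
  simp only [lastFactor, choose_two_succ (n + 1)]
  ring

lemma lastFactor_add (q x : ℂ) (r k : ℕ) :
    lastFactor q x (r + k) = lastFactor q x r * lastFactor q (x * q ^ r) k := by
  induction k with
  | zero => simp [lastFactor]
  | succ k ih => rw [← add_assoc, lastFactor_succ, lastFactor_succ, ih]; ring

lemma summable_lastFactor_mul {q : ℂ} (hq : ‖q‖ < 1) (x : ℂ) {g : ℕ → ℂ} {C R : ℝ}
    (hg : ∀ n, ‖g n‖ ≤ C * R ^ n) : Summable fun n => lastFactor q x n * g n := by
  refine Summable.of_norm_bounded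
    ((summable_pow_mul_pow_choose (norm_nonneg q) hq (‖x‖ * R)).mul_left C) fun n => ?_
  rw [norm_mul, norm_lastFactor]
  calc _ ≤ ‖x‖ ^ n * ‖q‖ ^ (n + 1).choose 2 * (C * R ^ n) :=
        mul_le_mul_of_nonneg_left (hg n) (by positivity)
    _ = _ := by rw [mul_pow]; ring

lemma norm_qBinom_div_shiftedPoch_le {q y : ℂ} (hq : ‖q‖ < 1) (hy : ‖y‖ ≤ 1) (r s t k : ℕ) :
    ‖qBinom q (r + k) s / shiftedPoch q y (t + k)‖ ≤
      2 ^ r * (1 - ‖q‖)⁻¹ ^ t * (2 * (1 - ‖q‖)⁻¹) ^ k := by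
  rw [div_eq_mul_inv, norm_mul]
  calc _ ≤ 2 ^ (r + k) * (1 - ‖q‖)⁻¹ ^ (t + k) :=
        mul_le_mul (norm_qBinom_le hq _ _) (norm_inv_shiftedPoch_le hq hy _) (norm_nonneg _)
          (by positivity)
    _ = _ := by rw [mul_pow]; ring

lemma summable_lastFactor_mul_qBinom_div {q y : ℂ} (hq : ‖q‖ < 1) (hy : ‖y‖ ≤ 1) (x : ℂ)
    (r s t : ℕ) :
    Summable fun k => lastFactor q x k * (qBinom q (r + k) s / shiftedPoch q y (t + k)) :=
  summable_lastFactor_mul hq x (norm_qBinom_div_shiftedPoch_le hq hy r s t)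

lemma hasSum_lastFactor_mul_qBinom_div {q y : ℂ} (hq : ‖q‖ < 1) (hy : ‖y‖ ≤ 1) (r : ℕ) :
    HasSum (fun k => lastFactor q y k * (qBinom q (r + k) r / shiftedPoch q y (r + 1 + k))) 1 := by
  induction r with
  | zero =>
    have hsum := summable_lastFactor_mul_qBinom_div hq hy y 0 0 1
    have hlim := (summable_lastFactor_mul_qBinom_div hq hy y 0 0 0).tendsto_atTop_zero
    refine (hsum.hasSum_iff_tendsto_nat).mpr ?_
    have e : ∀ N, ∑ k ∈ Finset.range N,
        lastFactor q y k * (qBinom q (0 + k) 0 / shiftedPoch q y (0 + 1 + k)) =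
        1 - lastFactor q y N * (qBinom q (0 + N) 0 / shiftedPoch q y (0 + N)) := by
      intro N
      induction N with
      | zero => simp [lastFactor, qBinom_zero_right, shiftedPoch_zero]
      | succ N ih =>
        have h1 := shiftedPoch_ne_zero hq hy N
        have h2 := one_sub_mul_pow_ne_zero hq hy N
        rw [Finset.sum_range_succ, ih, lastFactor_succ]
        simp only [qBinom_zero_right, zero_add, add_comm 1 N, shiftedPoch_succ]
        field_simp
        ring
    simp_rw [e]
    simpa using hlim.const_sub 1
  | succ r ih =>
    have hF := summable_lastFactor_mul_qBinom_div hq hy y (r + 1) (r + 1) (r + 1 + 1)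
    have hG := (summable_lastFactor_mul_qBinom_div hq hy y r (r + 1) (r + 1)).tendsto_atTop_zero
    have hd := hF.sub ih.summable
    have hzero : HasSum (fun k =>
        lastFactor q y k * (qBinom q (r + 1 + k) (r + 1) / shiftedPoch q y (r + 1 + 1 + k)) -
        lastFactor q y k * (qBinom q (r + k) r / shiftedPoch q y (r + 1 + k))) 0 := by
      refine (hd.hasSum_iff_tendsto_nat).mpr ?_
      have e : ∀ N, ∑ k ∈ Finset.range N,
          (lastFactor q y k * (qBinom q (r + 1 + k) (r + 1) / shiftedPoch q y (r + 1 + 1 + k)) -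
          lastFactor q y k * (qBinom q (r + k) r / shiftedPoch q y (r + 1 + k))) =
          -q ^ (r + 1) * (lastFactor q y N *
            (qBinom q (r + N) (r + 1) / shiftedPoch q y (r + 1 + N))) := by
        intro N
        induction N with
        | zero => simp [qBinom_eq_zero_of_lt q (Nat.lt_succ_self r)]
        | succ N ihN =>
          have h1 := shiftedPoch_ne_zero hq hy (r + 1 + N)
          have h2 := one_sub_mul_pow_ne_zero hq hy (r + 1 + N)
          rw [Finset.sum_range_succ, ihN, lastFactor_succ, show r + 1 + N = r + N + 1 by ring,
            show r + 1 + 1 + N = r + N + 1 + 1 by ring, ← add_assoc,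
            show r + 1 + (N + 1) = r + N + 1 + 1 by ring, qBinom_succ_succ,
            shiftedPoch_succ q y (r + N + 1)]
          rw [show r + 1 + N = r + N + 1 by ring] at h1 h2
          field_simp
          ring
      simp_rw [e]
      simpa using hG.const_mul (-q ^ (r + 1))
    simpa using hzero.add ih

lemma hasSum_lastFactor_mul_baileyKernel {q x : ℂ} (hq : ‖q‖ < 1) (hx : ‖x‖ ≤ 1) (r : ℕ) :
    HasSum (fun n => lastFactor q x n * baileyKernel q (x * q) n r)
      ((1 - x * q) * lastFactor q x r / shiftedPoch q x r) := by
  have hy : ‖x * q ^ r‖ ≤ 1 := norm_mul_pow_le hq hx r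
  have h1 : 1 - x * q ≠ 0 := by simpa using one_sub_mul_pow_ne_zero hq hx 0
  have h := (hasSum_lastFactor_mul_qBinom_div hq hy r).mul_left
    ((1 - x * q) * lastFactor q x r / shiftedPoch q x r)
  rw [mul_one] at h
  have hs : ∑ i ∈ Finset.range r, lastFactor q x i * baileyKernel q (x * q) i r = 0 :=
    Finset.sum_eq_zero fun i hi => by
      rw [baileyKernel_eq_zero_of_lt q _ (Finset.mem_range.mp hi), mul_zero]
  rw [← add_zero ((1 - x * q) * lastFactor q x r / shiftedPoch q x r), ← hs,
    ← hasSum_nat_add_iff r]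
  refine h.congr_fun fun k => ?_
  have h2 := shiftedPoch_ne_zero hq hx r
  have h3 := shiftedPoch_ne_zero hq hy (r + 1 + k)
  have h4 : shiftedPoch q x r * shiftedPoch q (x * q ^ r) (r + 1 + k) =
      (1 - x * q) * shiftedPoch q (x * q) (k + r + r) := by
    rw [← shiftedPoch_add, ← shiftedPoch_succ']
    congr 1
    ring
  have h5 : shiftedPoch q (x * q) (k + r + r) ≠ 0 :=
    shiftedPoch_ne_zero hq (by simpa using norm_mul_pow_le hq hx 1) _
  rw [baileyKernel, add_comm k r, lastFactor_add]
  rw [add_comm k r] at h4 h5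
  field_simp
  linear_combination (lastFactor q x r * lastFactor q (x * q ^ r) k * qBinom q (r + k) r) * h4

lemma norm_baileyKernel_le {q y : ℂ} (hq : ‖q‖ < 1) (hy : ‖y‖ ≤ 1) {n r : ℕ} (h : r ≤ n) :
    ‖baileyKernel q y n r‖ ≤ (2 * (1 - ‖q‖)⁻¹ ^ 2) ^ n := by
  have hM : 1 ≤ (1 - ‖q‖)⁻¹ := (one_le_inv₀ (by linarith)).mpr (by linarith [norm_nonneg q])
  rw [baileyKernel, div_eq_mul_inv, norm_mul, mul_pow, ← pow_mul]
  refine mul_le_mul (norm_qBinom_le hq _ _) ((norm_inv_shiftedPoch_le hq hy _).trans ?_)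
    (norm_nonneg _) (by positivity)
  exact pow_le_pow_right₀ hM (by omega)

lemma summable_lastFactor_mul_baileyKernel {q x : ℂ} (hq : ‖q‖ < 1) (hx : ‖x‖ ≤ 1) {A : ℕ → ℂ}
    {C D : ℝ} (hD : 1 ≤ D) (hA : ∀ r, ‖A r‖ ≤ C * D ^ r) :
    Summable fun i : ℕ × ℕ => lastFactor q x i.1 * (A i.2 * baileyKernel q (x * q) i.1 i.2) := by
  have hxq : ‖x * q‖ ≤ 1 := by simpa using norm_mul_pow_le hq hx 1
  have hC : 0 ≤ C := by simpa using (norm_nonneg _).trans (hA 0)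
  set E : ℝ := 2 * (1 - ‖q‖)⁻¹ ^ 2 with hE
  have hE0 : 0 ≤ E := by positivity
  have h1 := (summable_pow_mul_pow_choose (norm_nonneg q) hq (‖x‖ * (2 * D * E))).mul_left C
  have h2 := summable_geometric_of_lt_one (r := (1 / 2 : ℝ)) (by norm_num) (by norm_num)
  refine Summable.of_norm_bounded (h1.mul_of_nonneg h2 (fun n => by positivity)
    (fun n => by positivity)) ?_
  rintro ⟨n, r⟩
  dsimp only
  rcases lt_or_ge n r with h | h
  · rw [baileyKernel_eq_zero_of_lt q _ h]
    simp only [mul_zero, norm_zero]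
    positivity
  have h3 : D ^ r ≤ (2 * D) ^ n * (1 / 2) ^ r := by
    have h4 : (2 * D) ^ r ≤ (2 * D) ^ n := pow_le_pow_right₀ (by linarith) h
    calc D ^ r = (2 * D) ^ r * (1 / 2) ^ r := by rw [← mul_pow]; congr 1; ring
      _ ≤ _ := mul_le_mul_of_nonneg_right h4 (by positivity)
  rw [norm_mul, norm_mul, norm_lastFactor]
  calc _ ≤ ‖x‖ ^ n * ‖q‖ ^ (n + 1).choose 2 * (C * ((2 * D) ^ n * (1 / 2) ^ r) * E ^ n) := by
        refine mul_le_mul_of_nonneg_left (mul_le_mul ((hA r).trans ?_)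
          (norm_baileyKernel_le hq hxq h) (norm_nonneg _) (by positivity)) (by positivity)
        exact mul_le_mul_of_nonneg_left h3 hC
    _ = _ := by simp only [mul_pow]; ring

lemma hasSum_baileySum {q x : ℂ} (hq : ‖q‖ < 1) (hx : ‖x‖ ≤ 1) {A : ℕ → ℂ}
    {C D : ℝ} (hD : 1 ≤ D) (hA : ∀ r, ‖A r‖ ≤ C * D ^ r) :
    HasSum (fun r => A r * ((1 - x * q) * lastFactor q x r / shiftedPoch q x r))
      (∑' n, lastFactor q x n * baileySum q (x * q) A n) := by
  have hs := summable_lastFactor_mul_baileyKernel hq hx hD hA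
  have e : ∀ n, ∑' r, lastFactor q x n * (A r * baileyKernel q (x * q) n r) =
      lastFactor q x n * baileySum q (x * q) A n := by
    intro n
    rw [tsum_mul_left, baileySum, tsum_eq_sum]
    intro r hr
    rw [baileyKernel_eq_zero_of_lt q _ (by simpa [Nat.lt_succ_iff] using hr), mul_zero]
  have h1 := hs.tsum_prod
  simp only [e] at h1
  rw [← h1]
  refine HasSum.prod_fiberwise ((Equiv.prodComm ℕ ℕ).hasSum_iff.mpr hs.hasSum) fun r => ?_
  refine ((hasSum_lastFactor_mul_baileyKernel hq hx r).mul_left (A r)).congr_fun fun n => ?_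
  simp only [Function.comp, Equiv.prodComm_apply, Prod.swap]
  ring

/-- The product of the factors linking consecutive entries of `c`. -/
noncomputable def chain (q x : ℂ) (a p : ℕ) (c : Fin (p + 1) → ℕ) : ℂ :=
  ∏ j : Fin p, link q x a j (c j.castSucc) (c j.succ)

lemma Kterm_eq (p a : ℕ) (q x : ℂ) (c : Fin (p + 1) → ℕ) :
    Kterm p a q x c = lastFactor q x (c (Fin.last p)) * chain q x a p c := by
  simp only [Kterm, lastFactor, chain, link, Finset.prod_mul_distrib, Finset.prod_pow_eq_pow_sum,
    Finset.sum_add_distrib, Fin.sum_univ_castSucc, Nat.choose_two_right, Nat.add_sub_cancel]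
  rw [mul_comm (c (Fin.last p)) (c (Fin.last p) + 1), pow_add x]
  ring

lemma chain_snoc (q x : ℂ) (a p : ℕ) (n : ℕ) (c : Fin (p + 1) → ℕ) :
    chain q x a (p + 1) (Fin.snocEquiv (fun _ => ℕ) (n, c)) =
      link q x a p (c (Fin.last p)) n * chain q x a p c := by
  simp only [chain, Fin.prod_univ_castSucc (n := p), Fin.snocEquiv, Equiv.coe_fn_mk,
    Fin.snoc_castSucc, Fin.succ_last, Fin.snoc_last, Fin.succ_castSucc, Fin.val_castSucc,
    Fin.val_last]
  ring

lemma norm_link_le {q : ℂ} (hq : ‖q‖ < 1) (x : ℂ) (a j k n : ℕ) :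
    ‖link q x a j k n‖ ≤ 2 ^ (n + 1) * (‖x‖ ^ k * ‖q‖ ^ (k + 1).choose 2) := by
  rw [link, norm_mul, norm_mul, norm_pow, norm_pow, mul_comm]
  refine mul_le_mul ((norm_qBinom_le hq _ _).trans (pow_le_pow_right₀ one_le_two ?_))
    (mul_le_mul_of_nonneg_left (pow_le_pow_of_le_one (norm_nonneg _) hq.le ?_) (by positivity))
    (by positivity) (by positivity)
  · split_ifs <;> omega
  · have h : (k + 1).choose 2 ≤ k ^ 2 := by
      rw [Nat.choose_two_right]
      refine Nat.div_le_of_le_mul ?_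
      rcases k with _ | k
      · simp
      · simp only [Nat.add_sub_cancel]; nlinarith
    omega

lemma summable_mul_chain {q : ℂ} (hq : ‖q‖ < 1) (x : ℂ) (a p : ℕ) {f : ℕ → ℂ}
    (hf : Summable fun n => ‖f n‖ * 2 ^ n) :
    Summable fun c : Fin (p + 1) → ℕ => f (c (Fin.last p)) * chain q x a p c := by
  induction p generalizing f with
  | zero =>
    refine (Equiv.funUnique (Fin 1) ℕ).symm.summable_iff.mp ?_
    refine Summable.of_norm_bounded hf fun n => ?_
    simpa [chain] using le_mul_of_one_le_right (norm_nonneg (f n)) (one_le_pow₀ one_le_two)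
  | succ p ih =>
    refine (Fin.snocEquiv fun _ => ℕ).summable_iff.mp ?_
    have hg : Summable fun k => ‖x ^ k * q ^ (k + 1).choose 2‖ * 2 ^ k := by
      refine (summable_pow_mul_pow_choose (norm_nonneg q) hq (‖x‖ * 2)).congr fun k => ?_
      rw [norm_mul, norm_pow, norm_pow, mul_pow]
      ring
    refine Summable.of_norm_bounded ((hf.mul_left 2).mul_of_nonneg (ih hg).norm
      (fun n => by positivity) (fun c => norm_nonneg _)) ?_
    rintro ⟨n, c⟩
    rw [Function.comp, chain_snoc]
    simp only [Fin.snocEquiv, Equiv.coe_fn_mk, Fin.snoc_last]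
    rw [norm_mul, norm_mul, norm_mul, norm_mul, norm_pow, norm_pow]
    calc _ ≤ ‖f n‖ * (2 ^ (n + 1) * (‖x‖ ^ c (Fin.last p) *
          ‖q‖ ^ (c (Fin.last p) + 1).choose 2) * ‖chain q x a p c‖) :=
          mul_le_mul_of_nonneg_left (mul_le_mul_of_nonneg_right (norm_link_le hq x a p _ n)
            (norm_nonneg _)) (norm_nonneg _)
      _ = _ := by ring

lemma tsum_mul_chain {q : ℂ} (hq : ‖q‖ < 1) (x : ℂ) (a p : ℕ) {f : ℕ → ℂ}
    (hf : Summable fun n => ‖f n‖ * 2 ^ n) :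
    ∑' c : Fin (p + 1) → ℕ, f (c (Fin.last p)) * chain q x a p c =
      ∑' n, f n * chainSum q x a p n := by
  induction p generalizing f with
  | zero =>
    rw [← (Equiv.funUnique (Fin 1) ℕ).symm.tsum_eq]
    simp [chain, chainSum]
  | succ p ih =>
    have hs := ((Fin.snocEquiv fun _ => ℕ).summable_iff.mpr
      (summable_mul_chain hq x a (p + 1) hf)).tsum_prod
    simp only [Function.comp_apply] at hs
    rw [← (Fin.snocEquiv fun _ => ℕ).tsum_eq, hs]
    refine tsum_congr fun n => ?_
    simp only [chain_snoc]
    simp only [Fin.snocEquiv, Equiv.coe_fn_mk, Fin.snoc_last]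
    have hzero : ∀ k ∉ Finset.range (n + 2), link q x a p k n = 0 := fun k hk =>
      link_eq_zero_of_lt q x a p (by have := Finset.mem_range.not.mp hk; omega)
    have hl : Summable fun k => ‖link q x a p k n‖ * 2 ^ k :=
      summable_of_ne_finset_zero (s := Finset.range (n + 2)) fun k hk => by simp [hzero k hk]
    rw [tsum_mul_left, ih hl, chainSum, tsum_eq_sum (s := Finset.range (n + 2))]
    intro k hk
    rw [hzero k hk, zero_mul]

lemma summable_norm_lastFactor_mul {q : ℂ} (hq : ‖q‖ < 1) (x : ℂ) :
    Summable fun n => ‖lastFactor q x n‖ * 2 ^ n := by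
  refine (summable_pow_mul_pow_choose (norm_nonneg q) hq (‖x‖ * 2)).congr fun n => ?_
  rw [norm_lastFactor, mul_pow]
  ring

lemma summable_Kterm {q : ℂ} (hq : ‖q‖ < 1) (x : ℂ) (a p : ℕ) :
    Summable fun c : Fin (p + 1) → ℕ => Kterm p a q x c := by
  simp only [Kterm_eq]
  exact summable_mul_chain hq x a p (summable_norm_lastFactor_mul hq x)

lemma norm_shiftedAlpha_le {q x : ℂ} (hq : ‖q‖ < 1) (hx : ‖x‖ ≤ 1) (j r : ℕ) :
    ‖shiftedAlpha q x j r‖ ≤ ‖(1 - x * q)⁻¹‖ * 2 * 2 ^ r := by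
  have hp : ∀ n, ‖x ^ n‖ ≤ 1 := fun n => by
    rw [norm_pow]; exact pow_le_one₀ (norm_nonneg _) hx
  have hpq : ∀ n, ‖q ^ n‖ ≤ 1 := fun n => by
    rw [norm_pow]; exact pow_le_one₀ (norm_nonneg _) hq.le
  have h1 : ‖1 - x ^ j * q ^ (j * (2 * r + 1))‖ ≤ 2 := by
    refine (norm_sub_le _ _).trans ?_
    have := norm_mul_pow_le hq (hp j) (j * (2 * r + 1))
    rw [norm_one]
    linarith
  rw [shiftedAlpha, norm_mul, norm_mul, norm_mul, norm_mul, norm_mul, norm_mul]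
  have h2 : ‖((-1 : ℂ) ^ r)‖ * ‖q ^ (r + 1).choose 2‖ * ‖x ^ (j * r)‖ * ‖q ^ (j * r ^ 2)‖ ≤ 1 := by
    rw [norm_pow, norm_neg, norm_one, one_pow, one_mul]
    exact mul_le_one₀ (mul_le_one₀ (hpq _) (norm_nonneg _) (hp _)) (norm_nonneg _) (hpq _)
  calc _ ≤ ‖(1 - x * q)⁻¹‖ * 2 ^ r * (1 * 2) := by
        refine mul_le_mul (mul_le_mul_of_nonneg_left (norm_shiftedPoch_le hq hx r)
          (norm_nonneg _)) (mul_le_mul h2 h1 (norm_nonneg _) zero_le_one) (by positivity)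
          (by positivity)
    _ = _ := by ring

/-- The general term of the partial theta series equal to `K_m^{(a)}(x)`, with `m = a + d + 2`. -/
noncomputable def thetaTerm (q x : ℂ) (a d r : ℕ) : ℂ :=
  x ^ ((a + d + 2) * r) * q ^ ((a + d + 2) * r ^ 2 + (d + 1) * r) *
    (1 - x ^ (a + 1) * q ^ ((a + 1) * (2 * r + 1)))

lemma hasSum_thetaTerm {q x : ℂ} (hq0 : q ≠ 0) (hq : ‖q‖ < 1) (hx : ‖x‖ ≤ 1) (a d : ℕ) :
    HasSum (thetaTerm q x a d) (∑' c : Fin (a + d + 1) → ℕ, Kterm (a + d) a q x c) := by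
  simp only [Kterm_eq]
  rw [tsum_mul_chain hq x a (a + d) (summable_norm_lastFactor_mul hq x)]
  simp only [chainSum_add hq0 hq hx]
  have hxq : ‖x * q‖ ≤ 1 := by simpa using norm_mul_pow_le hq hx 1
  have hbound : ∀ r, ‖(x * q) ^ (d * r) * q ^ (d * r ^ 2) * shiftedAlpha q x (a + 1) r‖ ≤
      ‖(1 - x * q)⁻¹‖ * 2 * 2 ^ r := by
    intro r
    rw [norm_mul]
    refine (mul_le_of_le_one_left (norm_nonneg _) ?_).trans (norm_shiftedAlpha_le hq hx _ r)
    exact norm_mul_pow_le hq (by rw [norm_pow]; exact pow_le_one₀ (norm_nonneg _) hxq) _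
  refine (hasSum_baileySum hq hx one_le_two hbound).congr_fun fun r => ?_
  have h1 : 1 - x * q ≠ 0 := by simpa using one_sub_mul_pow_ne_zero hq hx 0
  have h2 := shiftedPoch_ne_zero hq hx r
  have h3 : (-1 : ℂ) ^ r * (-1) ^ r = 1 := by rw [← mul_pow]; simp
  have h4 : q ^ (r + 1).choose 2 * q ^ (r + 1).choose 2 = q ^ (r ^ 2 + r) := by
    rw [← pow_add, Nat.choose_two_right, Nat.add_sub_cancel, ← two_mul,
      Nat.mul_div_cancel' (by rw [mul_comm]; exact (Nat.even_mul_succ_self r).two_dvd)]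
    ring
  calc thetaTerm q x a d r
      = ((1 - x * q)⁻¹ * (1 - x * q)) * (shiftedPoch q x r / shiftedPoch q x r) *
        ((-1) ^ r * (-1) ^ r) * (q ^ (r + 1).choose 2 * q ^ (r + 1).choose 2) *
        ((x * q) ^ (d * r) * q ^ (d * r ^ 2) * (x ^ ((a + 1) * r) * q ^ ((a + 1) * r ^ 2) *
          (1 - x ^ (a + 1) * q ^ ((a + 1) * (2 * r + 1)))) * x ^ r) := by
        rw [inv_mul_cancel₀ h1, div_self h2, h3, h4, thetaTerm, mul_pow]
        ring
    _ = _ := by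
        rw [shiftedAlpha, lastFactor]
        ring

lemma thetaTerm_succ (q x : ℂ) (a d r : ℕ) :
    thetaTerm q x a d (r + 1) =
      x ^ (a + d + 2) * q ^ (a + 2 * d + 3) * thetaTerm q (q ^ 2 * x) a d r := by
  simp only [thetaTerm, mul_pow, ← pow_mul]
  ring

lemma tsum_Kterm_of_norm_le_one {q x : ℂ} (hq0 : q ≠ 0) (hq : ‖q‖ < 1) (hx : ‖x‖ ≤ 1) (a d : ℕ) :
    ∑' c : Fin (a + d + 1) → ℕ, Kterm (a + d) a q x c =
      1 - q ^ (a + 1) * x ^ (a + 1) + x ^ (a + d + 2) * q ^ (a + 2 * d + 3) *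
        ∑' c : Fin (a + d + 1) → ℕ, Kterm (a + d) a q (q ^ 2 * x) c := by
  have hx2 : ‖q ^ 2 * x‖ ≤ 1 := by rw [mul_comm]; exact norm_mul_pow_le hq hx 2
  have h := hasSum_thetaTerm hq0 hq hx a d
  rw [← h.tsum_eq, h.summable.tsum_eq_zero_add, ← (hasSum_thetaTerm hq0 hq hx2 a d).tsum_eq,
    ← tsum_mul_left]
  simp only [thetaTerm_succ]
  simp [thetaTerm, mul_comm]

lemma differentiable_tsum_Kterm {q : ℂ} (hq : ‖q‖ < 1) (a p : ℕ) :
    Differentiable ℂ fun x => ∑' c : Fin (p + 1) → ℕ, Kterm p a q x c := by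
  intro x
  have h := Complex.differentiableOn_tsum_of_summable_norm
    (U := Metric.ball (0 : ℂ) (‖x‖ + 1)) (F := fun c y => Kterm p a q y c)
    (summable_Kterm hq ((‖x‖ + 1 : ℝ) : ℂ) a p).norm
    (fun c => by unfold Kterm; fun_prop) Metric.isOpen_ball ?_
  · exact h.differentiableAt (Metric.isOpen_ball.mem_nhds (by simp))
  · intro c w hw
    simp only [Kterm, norm_mul, norm_pow]
    have hw' : ‖w‖ ≤ ‖((‖x‖ + 1 : ℝ) : ℂ)‖ := by
      rw [Complex.norm_real, Real.norm_of_nonneg (by positivity)]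
      exact (mem_ball_zero_iff.mp hw).le
    gcongr

/-- for `m ≥ 2`, `0 ≤ a ≤ m−2`, `0 < |q| < 1` and any `x : ℂ`, the series
`K_m^{(a)}(x)` converges and satisfies the `q`-difference equation
`K_m^{(a)}(x) = 1 − q^{a+1} x^{a+1} + x^m q^{2m−1−a} K_m^{(a)}(q² x)`. -/
theorem stmt4 (m p a : ℕ) (hm : m = p + 2) (ha : a ≤ m - 2) (q x : ℂ)
    (hq0 : q ≠ 0) (hq1 : ‖q‖ < 1) :
    HasSum (fun c : Fin (p + 1) → ℕ => Kterm p a q x c)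
      (1 - q ^ (a + 1) * x ^ (a + 1) +
        x ^ m * q ^ (2 * m - 1 - a) *
          ∑' c : Fin (p + 1) → ℕ, Kterm p a q (q ^ 2 * x) c) := by
  obtain ⟨d, rfl⟩ := Nat.exists_eq_add_of_le (show a ≤ p by omega)
  subst hm
  rw [show 2 * (a + d + 2) - 1 - a = a + 2 * d + 3 by omega]
  have hK := differentiable_tsum_Kterm hq1 a (a + d)
  have hR : Differentiable ℂ fun y : ℂ => 1 - q ^ (a + 1) * y ^ (a + 1) +
      y ^ (a + d + 2) * q ^ (a + 2 * d + 3) *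
        ∑' c : Fin (a + d + 1) → ℕ, Kterm (a + d) a q (q ^ 2 * y) c := by
    have := hK.comp (differentiable_id.const_mul (q ^ 2))
    simp only [Function.comp_def, id] at this
    fun_prop
  have hEq := AnalyticOnNhd.eq_of_eventuallyEq (z₀ := 0)
    (fun y _ => hK.analyticAt y) (fun y _ => hR.analyticAt y)
    (by filter_upwards [Metric.closedBall_mem_nhds (0 : ℂ) one_pos] with y hy
        exact tsum_Kterm_of_norm_le_one hq0 hq1 (mem_closedBall_zero_iff.mp hy) a d)
  rw [← congrFun hEq x]
  exact (summable_Kterm hq1 x a (a + d)).hasSum
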